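/- Let m, f, r₁, r₂ : ℝ² → ℝ be smooth functions and let L and G be LPDOs on ℝ² with smooth coefficients such that L ∘ (D_y + f) + r₁ = (D_x + m) ∘ G + r₂ as operators on smooth functions (here r₁ and r₂ denote multiplication operators, which have order ≤ 0, less than the order of the right factor D_y + f). Then there exists an LPDO N with smooth coefficients such that L = (D_x + m) ∘ N; consequently the common operator A = L ∘ (D_y + f) + r₁ admits the three-factor incomplete factorization A = (D_x + m) ∘ N ∘ (D_y + f) + r₁ with the same remainder r₁. (This is the key instance of the paper's main theorem on common obstacles, with symbols S₁ = X, S₃ = Y, gcd(S₁,S₃) = 1, and remainders of order less than ord S₃ = 1.) -/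

import Mathlib

/-- The partial derivative operator `D_x` acting on functions of two real variables. -/
noncomputable def Dx (u : ℝ × ℝ → ℝ) : ℝ × ℝ → ℝ := fun p => fderiv ℝ u p (1, 0)

/-- The partial derivative operator `D_y` acting on functions of two real variables. -/
noncomputable def Dy (u : ℝ × ℝ → ℝ) : ℝ × ℝ → ℝ := fun p => fderiv ℝ u p (0, 1)

/-- A linear partial differential operator on `ℝ²`: a finitely supported family of
smooth coefficients `a_{ij} : ℝ² → ℝ`. -/
structure LPDO2 where
  coeff : ℕ × ℕ → ℝ × ℝ → ℝ
  finite_support : {ij : ℕ × ℕ | coeff ij ≠ 0}.Finite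
  smooth_coeff : ∀ ij : ℕ × ℕ, ContDiff ℝ (⊤ : ℕ∞) (coeff ij)

/-- The action of an LPDO on a function: `Σ_{ij} a_{ij} ∂_x^i ∂_y^j u`. -/
noncomputable def LPDO2.apply (L : LPDO2) (u : ℝ × ℝ → ℝ) : ℝ × ℝ → ℝ :=
  fun p => ∑ᶠ ij : ℕ × ℕ, L.coeff ij p * (Dx^[ij.1] (Dy^[ij.2] u)) p

/-! ### Iterated commutators in an abstract ring -/

/-- `AdNilpotent X T` says that iterating `T ↦ T * X - X * T` eventually kills `T`. -/
inductive AdNilpotent {E : Type*} [Ring E] (X : E) : E → Prop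
  | zero : AdNilpotent X 0
  | step (T : E) : AdNilpotent X (T * X - X * T) → AdNilpotent X T

namespace AdNilpotent

variable {E : Type*} [Ring E] {X T S : E}

theorem commutator (h : AdNilpotent X T) : AdNilpotent X (T * X - X * T) := by
  cases h with
  | zero => simpa using zero
  | step _ h => exact h

theorem of_commute (h : Commute T X) : AdNilpotent X T :=
  step T (by simpa [h.eq] using zero)

theorem of_commutator_eq_one (h : T * X - X * T = 1) : AdNilpotent X T :=
  step T (h ▸ of_commute (Commute.one_left X))

theorem add (hT : AdNilpotent X T) (hS : AdNilpotent X S) : AdNilpotent X (T + S) := by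
  induction hT generalizing S with
  | zero => simpa using hS
  | step T _ ih =>
    refine step _ ?_
    convert ih hS.commutator using 1
    noncomm_ring

theorem mul (hT : AdNilpotent X T) (hS : AdNilpotent X S) : AdNilpotent X (T * S) := by
  induction hT generalizing S with
  | zero => simpa using zero
  | step T _ ihT =>
    induction hS with
    | zero => simpa using zero
    | step S hS ihS =>
      refine step _ ?_
      convert ihS.add (ihT (step S hS)) using 1
      noncomm_ring

theorem neg (hT : AdNilpotent X T) : AdNilpotent X (-T) := by
  simpa using (of_commute (Commute.neg_left (Commute.one_left X))).mul hT

theorem pow (hT : AdNilpotent X T) (n : ℕ) : AdNilpotent X (T ^ n) := by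
  induction n with
  | zero => simpa using of_commute (Commute.one_left X)
  | succ n ih => simpa [pow_succ] using ih.mul hT

variable [Algebra ℝ E]

theorem eq_zero_of_smul_eq_neg_left_mul {D : E} (hD : D * X - X * D = 1)
    (hT : AdNilpotent X T) {k : ℝ} (hk : 0 < k) (h : k • T = -(D * (T * X - X * T))) :
    T = 0 := by
  induction hT generalizing k with
  | zero => rfl
  | step T _ ih =>
    have key : T * X - X * T = 0 := by
      refine ih (k := k + 1) (by positivity) ?_
      have hDX : D * X = X * D + 1 := by rw [← hD]; abel
      have e : k • (T * X - X * T) = (k • T) * X - X * (k • T) := by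
        rw [smul_sub, smul_mul_assoc, mul_smul_comm]
      rw [add_smul, one_smul, e, h]
      generalize T * X - X * T = C
      have : X * (D * C) = D * X * C - C := by rw [hDX]; noncomm_ring
      rw [mul_neg, this]
      noncomm_ring
    rw [key] at h
    simpa [hk.ne'] using h

theorem eq_zero_of_smul_eq_neg_mul_right {B : E} (hB : B * X - X * B = 1)
    (hT : AdNilpotent X T) {k : ℝ} (hk : 0 < k) (h : k • T = -((T * X - X * T) * B)) :
    T = 0 := by
  induction hT generalizing k with
  | zero => rfl
  | step T _ ih =>
    have key : T * X - X * T = 0 := by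
      refine ih (k := k + 1) (by positivity) ?_
      have hBX : B * X = X * B + 1 := by rw [← hB]; abel
      have e : k • (T * X - X * T) = (k • T) * X - X * (k • T) := by
        rw [smul_sub, smul_mul_assoc, mul_smul_comm]
      rw [add_smul, one_smul, e, h]
      generalize T * X - X * T = C
      have : C * B * X = C * X * B + C := by rw [mul_assoc, hBX]; noncomm_ring
      rw [neg_mul, this]
      noncomm_ring
    rw [key] at h
    simpa [hk.ne'] using h

end AdNilpotent

/-- If `(D * N + R) * B + r = D * G + t`, where `D` and `B` are conjugate to `X` and `Y`
respectively and `B`, `R`, `r`, `t` commute with `X`, then `R = 0`. -/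
theorem remainder_eq_zero {E : Type*} [Ring E] [Algebra ℝ E] {X Y D B N G R r t : E}
    (hD : D * X - X * D = 1) (hB : B * Y - Y * B = 1) (hBX : Commute B X) (hRX : Commute R X)
    (hrX : Commute r X) (hrX' : Commute t X) (hrY : Commute r Y) (hrY' : Commute t Y)
    (hN : AdNilpotent X N) (hG : AdNilpotent X G) (hR : AdNilpotent Y R)
    (heq : (D * N + R) * B + r = D * G + t) : R = 0 := by
  have hsX : Commute (r - t) X := hrX.sub_left hrX'
  have hsY : Commute (r - t) Y := hrY.sub_left hrY'
  have hK : AdNilpotent X (N * B + -G) := (hN.mul (.of_commute hBX)).add hG.neg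
  have h : D * (N * B + -G) + R * B + (r - t) = 0 := by
    rw [← sub_eq_zero.2 heq]
    noncomm_ring
  generalize r - t = s at hsX hsY h
  generalize N * B + -G = K at hK h
  have hK0 : K = 0 := by
    refine hK.eq_zero_of_smul_eq_neg_left_mul hD one_pos ?_
    have hC : (R * B + s) * X - X * (R * B + s) = 0 :=
      sub_eq_zero.2 ((hRX.mul_left hBX).add_left hsX).eq
    have hW : (D * K + R * B + s) * X - X * (D * K + R * B + s) = 0 := by simp [h]
    have e : (D * K + R * B + s) * X - X * (D * K + R * B + s)
        = (D * X - X * D) * K + D * (K * X - X * K)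
          + ((R * B + s) * X - X * (R * B + s)) := by noncomm_ring
    rw [hW, hC, hD, one_mul, add_zero] at e
    rw [one_smul]
    exact eq_neg_of_add_eq_zero_left e.symm
  rw [hK0, mul_zero, zero_add] at h
  refine hR.eq_zero_of_smul_eq_neg_mul_right hB one_pos ?_
  have hW : (R * B + s) * Y - Y * (R * B + s) = 0 := by simp [h]
  have e : (R * B + s) * Y - Y * (R * B + s)
      = R * (B * Y - Y * B) + (R * Y - Y * R) * B + (s * Y - Y * s) := by noncomm_ring
  rw [hW, hB, mul_one, hsY.eq, sub_self, add_zero] at e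
  rw [one_smul]
  exact eq_neg_of_add_eq_zero_left e.symm

/-! ### Differential operators on the algebra of smooth functions -/

/-- The algebra of smooth functions on `ℝ²`. -/
def smoothFunctions : Subalgebra ℝ (ℝ × ℝ → ℝ) where
  carrier := {u | ContDiff ℝ (⊤ : ℕ∞) u}
  mul_mem' := by
    intro a b ha hb
    rw [Set.mem_ofPred_eq] at *
    exact ha.mul hb
  add_mem' := by
    intro a b ha hb
    rw [Set.mem_ofPred_eq] at *
    exact ha.add hb
  algebraMap_mem' := fun c => by
    rw [Set.mem_ofPred_eq]
    exact contDiff_const (c := c)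

theorem mem_smoothFunctions {u : ℝ × ℝ → ℝ} :
    u ∈ smoothFunctions ↔ ContDiff ℝ (⊤ : ℕ∞) u := Iff.rfl

theorem smoothFunctions.contDiff (u : smoothFunctions) : ContDiff ℝ (⊤ : ℕ∞) u.1 :=
  mem_smoothFunctions.1 u.2

theorem smoothFunctions.differentiableAt (u : smoothFunctions) (p : ℝ × ℝ) :
    DifferentiableAt ℝ u.1 p :=
  (smoothFunctions.contDiff u).differentiable (by simp) p

/-- The derivative in the direction `v`, as an endomorphism of the smooth functions. -/
noncomputable def directionalDeriv (v : ℝ × ℝ) : Module.End ℝ smoothFunctions where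
  toFun u := ⟨fun p => fderiv ℝ u.1 p v,
    mem_smoothFunctions.2 <|
      ((smoothFunctions.contDiff u).fderiv_right (m := (⊤ : ℕ∞)) (by simp)).clm_apply
        contDiff_const⟩
  map_add' u w := by
    ext p
    change fderiv ℝ (u.1 + w.1) p v = fderiv ℝ u.1 p v + fderiv ℝ w.1 p v
    rw [fderiv_add (smoothFunctions.differentiableAt u p) (smoothFunctions.differentiableAt w p)]
    rfl
  map_smul' c u := by
    ext p
    change fderiv ℝ (c • u.1) p v = c • fderiv ℝ u.1 p v
    rw [fderiv_const_smul (smoothFunctions.differentiableAt u p)]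
    rfl

/-- Multiplication by a smooth function, as an endomorphism of the smooth functions. -/
noncomputable def multiplication (g : smoothFunctions) : Module.End ℝ smoothFunctions :=
  LinearMap.mulLeft ℝ g

theorem multiplication_commute (g h : smoothFunctions) :
    Commute (multiplication g) (multiplication h) := by
  ext u : 1
  exact mul_left_comm g h u

theorem directionalDeriv_mul_multiplication (v : ℝ × ℝ) (g : smoothFunctions) :
    directionalDeriv v * multiplication g
      = multiplication g * directionalDeriv v + multiplication (directionalDeriv v g) := by
  ext u p
  change fderiv ℝ (g.1 * u.1) p v = g.1 p * fderiv ℝ u.1 p v + fderiv ℝ g.1 p v * u.1 p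
  rw [fderiv_mul (smoothFunctions.differentiableAt g p) (smoothFunctions.differentiableAt u p)]
  simp [mul_comm]

/-- The coordinate function `x`. -/
def coordX : smoothFunctions := ⟨Prod.fst, mem_smoothFunctions.2 contDiff_fst⟩

/-- The coordinate function `y`. -/
def coordY : smoothFunctions := ⟨Prod.snd, mem_smoothFunctions.2 contDiff_snd⟩

theorem directionalDeriv_coordX (v : ℝ × ℝ) :
    directionalDeriv v coordX = algebraMap ℝ smoothFunctions v.1 := by
  ext p
  change fderiv ℝ Prod.fst p v = v.1
  simp [fderiv_fst]

theorem directionalDeriv_coordY (v : ℝ × ℝ) :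
    directionalDeriv v coordY = algebraMap ℝ smoothFunctions v.2 := by
  ext p
  change fderiv ℝ Prod.snd p v = v.2
  simp [fderiv_snd]

theorem multiplication_one : multiplication 1 = 1 := LinearMap.mulLeft_one ℝ smoothFunctions

theorem multiplication_zero : multiplication 0 = 0 :=
  LinearMap.mulLeft_zero_eq_zero ℝ smoothFunctions

theorem commutator_directionalDeriv_add_multiplication (v : ℝ × ℝ) (a g : smoothFunctions)
    (h : directionalDeriv v g = 1) :
    (directionalDeriv v + multiplication a) * multiplication g
      - multiplication g * (directionalDeriv v + multiplication a) = 1 := by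
  rw [add_mul, mul_add, directionalDeriv_mul_multiplication, h, multiplication_one,
    (multiplication_commute a g).eq]
  abel

theorem commute_directionalDeriv_multiplication (v : ℝ × ℝ) (g : smoothFunctions)
    (h : directionalDeriv v g = 0) : Commute (directionalDeriv v) (multiplication g) := by
  rw [Commute, SemiconjBy, directionalDeriv_mul_multiplication, h, multiplication_zero, add_zero]

theorem directionalDeriv_x_coordX : directionalDeriv (1, 0) coordX = 1 := by
  simp [directionalDeriv_coordX]

theorem directionalDeriv_y_coordX : directionalDeriv (0, 1) coordX = 0 := by
  simp [directionalDeriv_coordX]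

theorem directionalDeriv_x_coordY : directionalDeriv (1, 0) coordY = 0 := by
  simp [directionalDeriv_coordY]

theorem directionalDeriv_y_coordY : directionalDeriv (0, 1) coordY = 1 := by
  simp [directionalDeriv_coordY]

theorem adNilpotent_directionalDeriv_of_eq_one (v : ℝ × ℝ) (g : smoothFunctions)
    (h : directionalDeriv v g = 1) : AdNilpotent (multiplication g) (directionalDeriv v) :=
  .of_commutator_eq_one <| by
    rw [directionalDeriv_mul_multiplication, h, multiplication_one]
    abel

/-- The differential operator `Σ a_{ij} ∂_x^i ∂_y^j` with the given coefficients. -/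
noncomputable def diffOp : (ℕ × ℕ →₀ smoothFunctions) →+ Module.End ℝ smoothFunctions :=
  Finsupp.liftAddHom fun ij =>
    { toFun := fun a =>
        multiplication a * (directionalDeriv (1, 0) ^ ij.1 * directionalDeriv (0, 1) ^ ij.2)
      map_zero' := by rw [multiplication_zero, zero_mul]
      map_add' := fun a b => by
        rw [← add_mul]
        congr 1
        ext u : 1
        exact add_mul a b u }

theorem diffOp_single (ij : ℕ × ℕ) (a : smoothFunctions) :
    diffOp (Finsupp.single ij a)
      = multiplication a * (directionalDeriv (1, 0) ^ ij.1 * directionalDeriv (0, 1) ^ ij.2) :=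
  Finsupp.liftAddHom_apply_single _ _ _

theorem adNilpotent_diffOp_coordX (c : ℕ × ℕ →₀ smoothFunctions) :
    AdNilpotent (multiplication coordX) (diffOp c) := by
  induction c using Finsupp.induction_linear with
  | zero => simpa using AdNilpotent.zero
  | add c d hc hd => simpa using hc.add hd
  | single ij a =>
    rw [diffOp_single]
    exact (AdNilpotent.of_commute (multiplication_commute a coordX)).mul <|
      ((adNilpotent_directionalDeriv_of_eq_one _ _ directionalDeriv_x_coordX).pow _).mul <|
      (AdNilpotent.of_commute
        (commute_directionalDeriv_multiplication _ _ directionalDeriv_y_coordX)).pow _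

/-- Left division with remainder of a differential operator by `∂_x + m`. -/
theorem exists_diffOp_eq_mul_add (m : smoothFunctions) (c : ℕ × ℕ →₀ smoothFunctions) :
    ∃ (n : ℕ × ℕ →₀ smoothFunctions) (R : Module.End ℝ smoothFunctions),
      diffOp c = (directionalDeriv (1, 0) + multiplication m) * diffOp n + R ∧
      Commute R (multiplication coordX) ∧ AdNilpotent (multiplication coordY) R := by
  have hadd : ∀ c d : ℕ × ℕ →₀ smoothFunctions, ∀ {n R n' R'},
      (diffOp c = (directionalDeriv (1, 0) + multiplication m) * diffOp n + R ∧
        Commute R (multiplication coordX) ∧ AdNilpotent (multiplication coordY) R) →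
      (diffOp d = (directionalDeriv (1, 0) + multiplication m) * diffOp n' + R' ∧
        Commute R' (multiplication coordX) ∧ AdNilpotent (multiplication coordY) R') →
      (diffOp (c + d) = (directionalDeriv (1, 0) + multiplication m) * diffOp (n + n') + (R + R') ∧
        Commute (R + R') (multiplication coordX) ∧
        AdNilpotent (multiplication coordY) (R + R')) := by
    rintro c d n R n' R' ⟨hc, hcX, hcY⟩ ⟨hd, hdX, hdY⟩
    refine ⟨?_, hcX.add_left hdX, hcY.add hdY⟩
    rw [map_add, map_add, hc, hd, mul_add]
    abel
  induction c using Finsupp.induction_linear with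
  | zero => exact ⟨0, 0, by simp, Commute.zero_left _, .zero⟩
  | add c d hc hd =>
    obtain ⟨n, R, h⟩ := hc
    obtain ⟨n', R', h'⟩ := hd
    exact ⟨n + n', R + R', hadd c d h h'⟩
  | single ij a =>
    obtain ⟨i, j⟩ := ij
    induction i generalizing a with
    | zero =>
      refine ⟨0, multiplication a * directionalDeriv (0, 1) ^ j, by simp [diffOp_single], ?_, ?_⟩
      · exact (multiplication_commute a coordX).mul_left
          ((commute_directionalDeriv_multiplication _ _ directionalDeriv_y_coordX).pow_left j)
      · exact (AdNilpotent.of_commute (multiplication_commute a coordY)).mul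
          ((adNilpotent_directionalDeriv_of_eq_one _ _ directionalDeriv_y_coordY).pow j)
    | succ i ih =>
      obtain ⟨n, R, hn, hX, hY⟩ := ih (-(directionalDeriv (1, 0) a + m * a))
      refine ⟨Finsupp.single (i, j) a + n, R, ?_, hX, hY⟩
      have hmul : multiplication a * directionalDeriv (1, 0)
          = (directionalDeriv (1, 0) + multiplication m) * multiplication a
            + multiplication (-(directionalDeriv (1, 0) a + m * a)) := by
        rw [add_mul, directionalDeriv_mul_multiplication]
        ext u : 1
        change a * directionalDeriv (1, 0) u = a * directionalDeriv (1, 0) u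
          + directionalDeriv (1, 0) a * u + m * (a * u)
          + -(directionalDeriv (1, 0) a + m * a) * u
        ring
      rw [map_add, mul_add, add_assoc, ← hn, diffOp_single, diffOp_single, diffOp_single,
        ← mul_assoc (_ + _), ← add_mul, ← hmul, pow_succ']
      simp only [mul_assoc]

/-! ### Comparison with `LPDO2` -/

/-- The coefficients of an `LPDO2`, as a finitely supported family of smooth functions. -/
noncomputable def LPDO2.toFinsupp (L : LPDO2) : ℕ × ℕ →₀ smoothFunctions :=
  Finsupp.ofSupportFinite (fun ij => ⟨L.coeff ij, mem_smoothFunctions.2 (L.smooth_coeff ij)⟩) <|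
    L.finite_support.subset fun _ hij h => hij (Subtype.ext h)

/-- The `LPDO2` with the given coefficients. -/
def LPDO2.ofFinsupp (c : ℕ × ℕ →₀ smoothFunctions) : LPDO2 where
  coeff ij := (c ij).1
  finite_support := c.hasFiniteSupport.subset fun _ hij h => hij (congrArg Subtype.val h)
  smooth_coeff ij := smoothFunctions.contDiff (c ij)

theorem directionalDeriv_pow_apply_coe (i j : ℕ) (u : smoothFunctions) :
    ((directionalDeriv (1, 0) ^ i * directionalDeriv (0, 1) ^ j) u).1 = Dx^[i] (Dy^[j] u.1) := by
  have hx : Function.Semiconj Subtype.val (directionalDeriv (1, 0)) Dx := fun _ => rfl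
  have hy : Function.Semiconj Subtype.val (directionalDeriv (0, 1)) Dy := fun _ => rfl
  rw [Module.End.mul_apply, Module.End.pow_apply, Module.End.pow_apply, hx.iterate_right i,
    hy.iterate_right j]

theorem LPDO2.ofFinsupp_apply (c : ℕ × ℕ →₀ smoothFunctions) (u : smoothFunctions) :
    (LPDO2.ofFinsupp c).apply u.1 = (diffOp c u).1 := by
  funext p
  have h : diffOp c = ∑ ij ∈ c.support, multiplication (c ij)
      * (directionalDeriv (1, 0) ^ ij.1 * directionalDeriv (0, 1) ^ ij.2) :=
    Finsupp.liftAddHom_apply _ _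
  rw [h, LinearMap.sum_apply, AddSubmonoidClass.coe_finsetSum, Finset.sum_apply]
  refine (finsum_eq_sum_of_support_subset _ (s := c.support) ?_).trans
    (Finset.sum_congr rfl fun ij _ => ?_)
  · intro ij hij
    simp only [Finset.mem_coe, Finsupp.mem_support_iff]
    intro h0
    exact hij (by simp [LPDO2.ofFinsupp, h0])
  · rw [← directionalDeriv_pow_apply_coe]
    rfl

theorem LPDO2.apply_eq_diffOp (L : LPDO2) (u : smoothFunctions) :
    L.apply u.1 = (diffOp L.toFinsupp u).1 :=
  LPDO2.ofFinsupp_apply L.toFinsupp u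

/-- If `L ∘ (D_y + f) + r₁ = (D_x + m) ∘ G + r₂` as operators on smooth functions,
then there is an LPDO `N` with `L = (D_x + m) ∘ N`, and consequently
`A = L ∘ (D_y + f) + r₁ = (D_x + m) ∘ N ∘ (D_y + f) + r₁`. -/
theorem refinement_of_incomplete_factorizations
    (m f r₁ r₂ : ℝ × ℝ → ℝ)
    (hm : ContDiff ℝ (⊤ : ℕ∞) m) (hf : ContDiff ℝ (⊤ : ℕ∞) f)
    (hr₁ : ContDiff ℝ (⊤ : ℕ∞) r₁) (hr₂ : ContDiff ℝ (⊤ : ℕ∞) r₂)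
    (L G : LPDO2)
    (heq : ∀ u : ℝ × ℝ → ℝ, ContDiff ℝ (⊤ : ℕ∞) u → ∀ p : ℝ × ℝ,
      L.apply (fun q => Dy u q + f q * u q) p + r₁ p * u p
        = Dx (G.apply u) p + m p * G.apply u p + r₂ p * u p) :
    ∃ N : LPDO2,
      (∀ u : ℝ × ℝ → ℝ, ContDiff ℝ (⊤ : ℕ∞) u → ∀ p : ℝ × ℝ,
        L.apply u p = Dx (N.apply u) p + m p * N.apply u p) ∧
      (∀ u : ℝ × ℝ → ℝ, ContDiff ℝ (⊤ : ℕ∞) u → ∀ p : ℝ × ℝ,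
        L.apply (fun q => Dy u q + f q * u q) p + r₁ p * u p
          = Dx (N.apply (fun q => Dy u q + f q * u q)) p
            + m p * N.apply (fun q => Dy u q + f q * u q) p
            + r₁ p * u p) := by
  rw [← mem_smoothFunctions] at hm hf hr₁ hr₂
  set E := Module.End ℝ smoothFunctions
  set D : E := directionalDeriv (1, 0) + multiplication ⟨m, hm⟩ with hD
  set B : E := directionalDeriv (0, 1) + multiplication ⟨f, hf⟩
  have hop : diffOp L.toFinsupp * B + multiplication ⟨r₁, hr₁⟩
      = D * diffOp G.toFinsupp + multiplication ⟨r₂, hr₂⟩ := by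
    ext u p
    have h := heq u.1 (smoothFunctions.contDiff u) p
    rw [G.apply_eq_diffOp u] at h
    rw [show (fun q => Dy u.1 q + f q * u.1 q) = (B u).1 from rfl, L.apply_eq_diffOp] at h
    exact h
  obtain ⟨n, R, hdiv, hRX, hRY⟩ := exists_diffOp_eq_mul_add ⟨m, hm⟩ L.toFinsupp
  rw [← hD] at hdiv
  have hBX : Commute B (multiplication coordX) :=
    (commute_directionalDeriv_multiplication _ _ directionalDeriv_y_coordX).add_left
      (multiplication_commute _ _)
  have hR : R = 0 := by
    rw [hdiv] at hop
    exact remainder_eq_zero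
      (commutator_directionalDeriv_add_multiplication _ _ _ directionalDeriv_x_coordX)
      (commutator_directionalDeriv_add_multiplication _ _ _ directionalDeriv_y_coordY)
      hBX hRX (multiplication_commute _ _) (multiplication_commute _ _)
      (multiplication_commute _ _) (multiplication_commute _ _)
      (adNilpotent_diffOp_coordX n) (adNilpotent_diffOp_coordX _) hRY hop
  rw [hR, add_zero] at hdiv
  have hfac : ∀ u : ℝ × ℝ → ℝ, ContDiff ℝ (⊤ : ℕ∞) u → ∀ p : ℝ × ℝ,
      L.apply u p
        = Dx ((LPDO2.ofFinsupp n).apply u) p + m p * (LPDO2.ofFinsupp n).apply u p := by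
    intro u hu p
    rw [← mem_smoothFunctions] at hu
    rw [L.apply_eq_diffOp ⟨u, hu⟩, LPDO2.ofFinsupp_apply n ⟨u, hu⟩, hdiv]
    rfl
  refine ⟨LPDO2.ofFinsupp n, hfac, fun u hu p => ?_⟩
  rw [hfac (fun q => Dy u q + f q * u q)
    (smoothFunctions.contDiff (B ⟨u, mem_smoothFunctions.2 hu⟩)) p]
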